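/- arXiv:1603.03855 — 2 statements merged into one kernel-verified Lean document; each statement's English description precedes it below -/
import Mathlib

section
/- Let H be a graph, let k ∈ {0,1}, let a be a vertex of H of degree 2, let e1, e2 be edges of H (not necessarily distinct), and let G = H ∘ (e1, e2, a). If p is a real number such that φ(H − W) ≤ p for every set W of edges of H with |W| = k, then φ(G − W') ≤ p + 1 for every set W' of edges of G with |W'| = k. (Here G − W denotes the graph obtained from G by deleting the edges in W.) -/
open SimpleGraph

namespace InducedForest

/-- A graph is subcubic if every vertex has at most 3 neighbours. -/
def Subcubic {V : Type} (G : SimpleGraph V) : Prop := ∀ v : V, (G.neighborSet v).ncard ≤ 3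

/-- A graph is cubic if every vertex has exactly 3 neighbours. -/
def Cubic {V : Type} (G : SimpleGraph V) : Prop := ∀ v : V, (G.neighborSet v).ncard = 3

/-- `S` is a feedback vertex set of `G` iff `G - S` is a forest. -/
def IsFVS {V : Type} (G : SimpleGraph V) (S : Set V) : Prop := (G.induce Sᶜ).IsAcyclic

/-- `φ(G)`: the minimum size of a feedback vertex set of `G`. -/
noncomputable def fvs {V : Type} (G : SimpleGraph V) : ℕ :=
  sInf {n : ℕ | ∃ S : Set V, IsFVS G S ∧ S.ncard = n}

/-- `a(G)`: the maximum number of vertices of an induced forest in `G`. -/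
noncomputable def indForestNum {V : Type} (G : SimpleGraph V) : ℕ :=
  sSup {n : ℕ | ∃ S : Set V, (G.induce S).IsAcyclic ∧ S.ncard = n}

/-- `v` is a cut-vertex of `G`: deleting it increases the number of connected components. -/
def IsCutVertex {V : Type} (G : SimpleGraph V) (v : V) : Prop :=
  Nat.card G.ConnectedComponent < Nat.card (G.induce {u | u ≠ v}).ConnectedComponent

/-- `B` is a block of `G`: a maximal set of vertices inducing a connected subgraph
without cut-vertices. -/
def IsBlock {V : Type} (G : SimpleGraph V) (B : Set V) : Prop :=
  ((G.induce B).Connected ∧ ∀ v, ¬ IsCutVertex (G.induce B) v) ∧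
  ∀ B' : Set V, B ⊆ B' →
    ((G.induce B').Connected ∧ ∀ v, ¬ IsCutVertex (G.induce B') v) → B' = B

/-- 2-connectedness: at least 3 vertices and removing fewer than 2 vertices
leaves a connected graph. -/
def TwoConnected {V : Type} (G : SimpleGraph V) : Prop :=
  3 ≤ Nat.card V ∧ ∀ s : Set V, s.ncard < 2 → (G.induce sᶜ).Connected

/-- 3-connectedness: at least 4 vertices and removing fewer than 3 vertices
leaves a connected graph. -/
def ThreeConnected {V : Type} (G : SimpleGraph V) : Prop :=
  4 ≤ Nat.card V ∧ ∀ s : Set V, s.ncard < 3 → (G.induce sᶜ).Connected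

/-- The graph obtained from `H` by subdividing the edge `xy` once;
the subdivision vertex is `none`. -/
def subdivide {V : Type} (H : SimpleGraph V) (x y : V) : SimpleGraph (Option V) :=
  SimpleGraph.fromRel (fun p q =>
    match p, q with
    | some u, some v => H.Adj u v ∧ s(u, v) ≠ s(x, y)
    | some u, none => u = x ∨ u = y
    | _, _ => False)

/-- `G` is obtained from `H` by subdividing one edge once. -/
def IsSubdivisionOfOneEdge {V W : Type} (H : SimpleGraph V) (G : SimpleGraph W) : Prop :=
  ∃ x y : V, H.Adj x y ∧ Nonempty (G ≃g subdivide H x y)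

/-- The graph obtained from `K` by adding one new vertex (`none`)
joined to all vertices of `S`. -/
def addApex {V : Type} (K : SimpleGraph V) (S : Set V) : SimpleGraph (Option V) :=
  SimpleGraph.fromRel (fun p q =>
    match p, q with
    | some u, some v => K.Adj u v
    | some u, none => u ∈ S
    | _, _ => False)

/-- `G` is (isomorphic to) `H ∘ (e1, e2, a)`: subdivide `e1` and `e2` once each
(with `e1` subdivided twice if `e1 = e2`) and add a new vertex adjacent to `a` and to the
two subdivision vertices. -/
def IsCircOp {V W : Type} (H : SimpleGraph V) (e1 e2 : Sym2 V) (a : V)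
    (G : SimpleGraph W) : Prop :=
  (e1 ≠ e2 ∧ ∃ x1 y1 x2 y2 : V, e1 = s(x1, y1) ∧ e2 = s(x2, y2) ∧
    Nonempty (G ≃g addApex (subdivide (subdivide H x1 y1) (some x2) (some y2))
      {some (some a), some none, none})) ∨
  (e1 = e2 ∧ ∃ x y : V, e1 = s(x, y) ∧
    Nonempty (G ≃g addApex (subdivide (subdivide H x y) none (some y))
      {some (some a), some none, none}))

/-- The cycle of length `n` (for `n ≥ 3`). -/
def cyc (n : ℕ) : SimpleGraph (ZMod n) :=
  SimpleGraph.fromRel (fun u v => v = u + 1)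

/-- The families `F_{i,j}` of graphs (closed under isomorphism):
`F_{i,0} = {C_i}` for `i ≥ 3`; `F_{1,1} = {K_4}`; `F_{j,j}` for `j ≥ 2` is obtained from
`F_{j-1,j-1}` by subdividing one edge once and then applying the `∘` operation at the
subdivision vertex; and `F_{i,j}` for `i > j ≥ 1` is obtained from `F_{j,j}` by `i - j`
successive single-edge subdivisions. -/
inductive MemF : ℕ → ℕ → ∀ {V : Type}, SimpleGraph V → Prop
  | cycle {i : ℕ} (hi : 3 ≤ i) {V : Type} {G : SimpleGraph V}
      (h : Nonempty (G ≃g cyc i)) : MemF i 0 G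
  | k4 {V : Type} {G : SimpleGraph V}
      (h : Nonempty (G ≃g (⊤ : SimpleGraph (Fin 4)))) : MemF 1 1 G
  | circ {j : ℕ} (hj : 2 ≤ j) {V : Type} {H : SimpleGraph V}
      (hH : MemF (j - 1) (j - 1) H) {x y : V} (hxy : H.Adj x y)
      {e1 e2 : Sym2 (Option V)} (he1 : e1 ∈ (subdivide H x y).edgeSet)
      (he2 : e2 ∈ (subdivide H x y).edgeSet)
      {W : Type} {G : SimpleGraph W}
      (hG : IsCircOp (subdivide H x y) e1 e2 none G) : MemF j j G
  | subd {i j : ℕ} (hj : 1 ≤ j) {V : Type} {H : SimpleGraph V}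
      (hH : MemF i j H) {x y : V} (hxy : H.Adj x y) {W : Type} {G : SimpleGraph W}
      (hG : Nonempty (G ≃g subdivide H x y)) : MemF (i + 1) j G

/-- `K_4^+`: the graph obtained from `K_4` by subdividing one edge once. -/
def K4plus : SimpleGraph (Option (Fin 4)) :=
  subdivide (⊤ : SimpleGraph (Fin 4)) 0 1

/-- `L`: the graph obtained from `K_4` by subdividing once each edge
of a perfect matching. -/
def Lgraph : SimpleGraph (Option (Option (Fin 4))) :=
  subdivide (subdivide (⊤ : SimpleGraph (Fin 4)) 0 1) (some 2) (some 3)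

/-- The Petersen graph. -/
def petersen : SimpleGraph (ZMod 5 × Fin 2) :=
  SimpleGraph.fromRel (fun u v =>
    (u.2 = 0 ∧ v.2 = 0 ∧ v.1 = u.1 + 1) ∨
    (u.2 = 1 ∧ v.2 = 1 ∧ v.1 = u.1 + 2) ∨
    (u.2 = 0 ∧ v.2 = 1 ∧ u.1 = v.1))

/-- `R`: the Petersen graph minus one edge. -/
def Rgraph : SimpleGraph (ZMod 5 × Fin 2) :=
  petersen.deleteEdges {s(((0 : ZMod 5), (0 : Fin 2)), ((1 : ZMod 5), (0 : Fin 2)))}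

/-- `Q_3`: the 3-dimensional cube graph. -/
def Q3 : SimpleGraph (Fin 2 × Fin 2 × Fin 2) :=
  SimpleGraph.fromRel (fun u v =>
    (u.1 ≠ v.1 ∧ u.2 = v.2) ∨ (u.1 = v.1 ∧ u.2.1 ≠ v.2.1 ∧ u.2.2 = v.2.2) ∨
    (u.1 = v.1 ∧ u.2.1 = v.2.1 ∧ u.2.2 ≠ v.2.2))

/-- `V_8`: the Wagner graph. -/
def V8 : SimpleGraph (ZMod 8) :=
  SimpleGraph.fromRel (fun u v => v = u + 1 ∨ v = u + 4)

/-- The dodecahedron, presented as the generalized Petersen graph `GP(10,2)`. -/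
def dodecahedron : SimpleGraph (ZMod 10 × Fin 2) :=
  SimpleGraph.fromRel (fun u v =>
    (u.2 = 0 ∧ v.2 = 0 ∧ v.1 = u.1 + 1) ∨
    (u.2 = 1 ∧ v.2 = 1 ∧ v.1 = u.1 + 2) ∨
    (u.2 = 0 ∧ v.2 = 1 ∧ u.1 = v.1))

/-- The families `F^g_{i,j,k}`: 2-connected subcubic graphs obtained from the disjoint
union of `k` copies of `L` (when `g = 4`) or of `R` (when `g = 5`) and one member of
`F_{i,j}` by adding `k+1` edges; when `k ≥ 1`, each added edge joins two different
constituent copies. -/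
def MemFG (g i j k : ℕ) {W : Type} (G : SimpleGraph W) : Prop :=
  TwoConnected G ∧ Subcubic G ∧
  ∃ (P : W → Fin (k + 1)) (H : SimpleGraph W),
    H ≤ G ∧ (∀ u v, H.Adj u v → P u = P v) ∧
    MemF i j (H.induce (P ⁻¹' {0})) ∧
    ((g = 4 ∧ ∀ l : Fin (k + 1), l ≠ 0 → Nonempty ((H.induce (P ⁻¹' {l})) ≃g Lgraph)) ∨
     (g = 5 ∧ ∀ l : Fin (k + 1), l ≠ 0 → Nonempty ((H.induce (P ⁻¹' {l})) ≃g Rgraph))) ∧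
    (G.edgeSet \ H.edgeSet).ncard = k + 1 ∧
    (1 ≤ k → ∀ u v, G.Adj u v → ¬ H.Adj u v → P u ≠ P v)

/-- `t_4 = 2/9`, `t_5 = 1/5`. -/
noncomputable def tg (g : ℕ) : ℝ := if g = 4 then 2 / 9 else 1 / 5

/-- The error function `ε_g` on graphs. -/
noncomputable def eps (g : ℕ) {V : Type} (G : SimpleGraph V) : ℝ := by
  classical
  exact
    if h1 : ∃ p : ℕ × ℕ, 1 ≤ p.1 ∧ p.2 ≤ p.1 ∧ MemF p.1 p.2 G then
      max (1 - (h1.choose.2 : ℝ) * (5 * tg g - 1) - (h1.choose.1 : ℝ) * tg g) 0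
    else if h2 : ∃ q : ℕ × ℕ × ℕ, 1 ≤ q.1 ∧ q.2.1 ≤ q.1 ∧ MemFG g q.1 q.2.1 q.2.2 G then
      max (1 - tg g - (h2.choose.2.1 : ℝ) * (5 * tg g - 1) - (h2.choose.1 : ℝ) * tg g) 0
    else if Nonempty (G ≃g (⊤ : SimpleGraph (Fin 2))) then -tg g
    else 0

/-- The error function `r_g(G)`: the sum of `ε_g(B)` over all blocks `B` of `G`. -/
noncomputable def rg (g : ℕ) {V : Type} (G : SimpleGraph V) : ℝ :=
  ∑ᶠ B ∈ {B : Set V | IsBlock G B}, eps g (G.induce B)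

/-- `G` has two vertex-disjoint cycles, each of length less than `g`. -/
def TwoDisjointCyclesLt {V : Type} (G : SimpleGraph V) (g : ℕ) : Prop :=
  ∃ (u v : V) (c1 : G.Walk u u) (c2 : G.Walk v v), c1.IsCycle ∧ c2.IsCycle ∧
    c1.length < g ∧ c2.length < g ∧ ∀ x, x ∈ c1.support → x ∉ c2.support

/-- `G` contains a (not necessarily induced) subgraph isomorphic to `K`. -/
def ContainsSubgraphCopy {U V : Type} (K : SimpleGraph U) (G : SimpleGraph V) : Prop :=
  ∃ f : U → V, Function.Injective f ∧ ∀ u v, K.Adj u v → G.Adj (f u) (f v)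

/-- `G` is obtained from `H` by adding edges, each of which is a cut-edge of `G`. -/
def AddCutEdges {V : Type} (H G : SimpleGraph V) : Prop :=
  H ≤ G ∧ ∀ e ∈ G.edgeSet \ H.edgeSet, G.IsBridge e

/-- The edges of `H` all lie inside the parts of the partition given by `P`. -/
def PartitionedBy {V ι : Type} (H : SimpleGraph V) (P : V → ι) : Prop :=
  ∀ u v, H.Adj u v → P u = P v

/-- `G` is `g`-minimal: a minimum counterexample to the main theorem. -/
def GMinimal (g : ℕ) {V : Type} [Fintype V] (G : SimpleGraph V) : Prop :=
  Subcubic G ∧ ¬ TwoDisjointCyclesLt G g ∧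
  tg g * G.edgeSet.ncard + rg g G < (fvs G : ℝ) ∧
  ∀ (W : Type) [Fintype W] (H : SimpleGraph W), Nat.card W < Nat.card V →
    Subcubic H → ¬ TwoDisjointCyclesLt H g →
    (fvs H : ℝ) ≤ tg g * H.edgeSet.ncard + rg g H

def LF {V : Type} (G : SimpleGraph V) (S : Set V) : Prop :=
  ∀ T : Set V, T.Nonempty → (∀ t ∈ T, t ∉ S) →
    ∃ z ∈ T, ∀ x ∈ T, ∀ y ∈ T, G.Adj z x → G.Adj z y → x = y

theorem LF_of_isFVS {V : Type} [Finite V] {G : SimpleGraph V} {S : Set V}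
    (h : IsFVS G S) : LF G S := by
  classical
  intro T hT hd
  have hle : T ⊆ Sᶜ := fun t ht => hd t ht
  have hac : (G.induce T).IsAcyclic :=
    IsAcyclic.embedding (SimpleGraph.induceHomOfLE G hle) h
  obtain ⟨t, ht⟩ := hT
  let c := (G.induce T).connectedComponentMk ⟨t, ht⟩
  have htree := hac.isTree_connectedComponent c
  by_cases hn : Nontrivial c
  · have : Fintype c := Fintype.ofFinite _
    obtain ⟨⟨⟨v, hvT⟩, hv⟩, hdeg⟩ := htree.exists_vert_degree_one_of_nontrivial
    refine ⟨v, hvT, fun x hx y hy hvx hvy => ?_⟩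
    rw [SimpleGraph.degree_eq_one_iff_existsUnique_adj] at hdeg
    have key : ∀ x (hx : x ∈ T), G.Adj v x → (⟨x, hx⟩ : T) ∈ c.supp := by
      intro x hx hvx
      have h1 : (G.induce T).Adj ⟨v, hvT⟩ ⟨x, hx⟩ := hvx
      exact (c.mem_supp_congr_adj h1).1 hv
    have := hdeg.unique (y₁ := ⟨⟨x, hx⟩, key x hx hvx⟩) (y₂ := ⟨⟨y, hy⟩, key y hy hvy⟩) hvx hvy
    simpa using this
  · refine ⟨t, ht, fun x hx y hy hvx hvy => ?_⟩
    exfalso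
    apply hn
    have h1 : (G.induce T).Adj ⟨t, ht⟩ ⟨x, hx⟩ := hvx
    have h0 : (⟨t, ht⟩ : T) ∈ c.supp := rfl
    refine ⟨⟨⟨t, ht⟩, h0⟩, ⟨⟨x, hx⟩, (c.mem_supp_congr_adj h1).1 h0⟩, ?_⟩
    intro hh
    simp at hh
    exact hvx.ne hh

theorem isFVS_of_LF {V : Type} {G : SimpleGraph V} {S : Set V}
    (h : LF G S) : IsFVS G S := by
  classical
  intro v c hc
  obtain ⟨z, ⟨⟨z', hz'⟩, hzs, rfl⟩, hz⟩ := h (Subtype.val '' {x | x ∈ c.support})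
    ⟨_, v, c.start_mem_support, rfl⟩ (by rintro _ ⟨⟨x, hx⟩, _, rfl⟩; exact hx)
  have h2 := hc.ncard_neighborSet_toSubgraph_eq_two hzs
  obtain ⟨x, y, hxy, hs⟩ := Set.ncard_eq_two.1 h2
  have hx : x ∈ c.toSubgraph.neighborSet ⟨z', hz'⟩ := by rw [hs]; simp
  have hy : y ∈ c.toSubgraph.neighborSet ⟨z', hz'⟩ := by rw [hs]; simp
  apply hxy
  apply Subtype.ext
  have hx' := c.toSubgraph.edge_vert hx.symm
  have hy' := c.toSubgraph.edge_vert hy.symm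
  rw [Walk.mem_verts_toSubgraph] at hx' hy'
  exact hz x ⟨x, hx', rfl⟩ y ⟨y, hy', rfl⟩ hx.adj_sub hy.adj_sub

theorem LF_iso {V W : Type} {G : SimpleGraph V} {K : SimpleGraph W} (f : V ≃ W)
    (hf : ∀ x y, G.Adj x y → K.Adj (f x) (f y)) {S : Set W} (h : LF K S) :
    LF G (f ⁻¹' S) := by
  intro T hT hd
  obtain ⟨_, ⟨z, hzT, rfl⟩, hz⟩ := h (f '' T) (hT.image f)
    (by rintro _ ⟨t, ht, rfl⟩; exact hd t ht)
  exact ⟨z, hzT, fun x hx y hy hzx hzy => f.injective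
    (hz _ ⟨x, hx, rfl⟩ _ ⟨y, hy, rfl⟩ (hf _ _ hzx) (hf _ _ hzy))⟩

/-- adding back a vertex with at most one neighbour outside `S` -/
theorem LF_pendant {V : Type} {J : SimpleGraph V} {L : SimpleGraph (Option V)} {S : Set V}
    (h : LF J S) (hL : ∀ x y, L.Adj (some x) (some y) → J.Adj x y)
    (hp : ∀ x y, x ∉ S → y ∉ S → L.Adj none (some x) → L.Adj none (some y) → x = y) :
    LF L (some '' S) := by
  intro T hT hd
  by_cases hn : none ∈ T
  · refine ⟨none, hn, ?_⟩
    rintro (_ | x) hx (_ | y) hy hzx hzy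
    · rfl
    · exact absurd hzx (L.loopless.irrefl _)
    · exact absurd hzy (L.loopless.irrefl _)
    · rw [hp x y (fun hh => hd _ hx ⟨x, hh, rfl⟩) (fun hh => hd _ hy ⟨y, hh, rfl⟩) hzx hzy]
  · obtain ⟨z, hzT, hz⟩ := h (some ⁻¹' T) (by
      obtain ⟨(_ | t), ht⟩ := hT
      · exact absurd ht hn
      · exact ⟨t, ht⟩) (fun t ht hS => hd _ ht ⟨t, hS, rfl⟩)
    refine ⟨some z, hzT, ?_⟩
    rintro (_ | x) hx (_ | y) hy hzx hzy
    · rfl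
    · exact absurd hx hn
    · exact absurd hy hn
    · rw [hz x hx y hy (hL _ _ hzx) (hL _ _ hzy)]

theorem LF_insert {V : Type} {J : SimpleGraph V} {L : SimpleGraph (Option V)} {S : Set V}
    (h : LF J S) (hL : ∀ x y, L.Adj (some x) (some y) → J.Adj x y) :
    LF L (insert none (some '' S)) := by
  intro T hT hd
  have hn : none ∉ T := fun hh => hd _ hh (Set.mem_insert _ _)
  obtain ⟨z, hzT, hz⟩ := h (some ⁻¹' T) (by
      obtain ⟨(_ | t), ht⟩ := hT
      · exact absurd ht hn
      · exact ⟨t, ht⟩) (fun t ht hS => hd _ ht (Set.mem_insert_of_mem _ ⟨t, hS, rfl⟩))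
  refine ⟨some z, hzT, ?_⟩
  rintro (_ | x) hx (_ | y) hy hzx hzy
  · rfl
  · exact absurd hx hn
  · exact absurd hy hn
  · rw [hz x hx y hy (hL _ _ hzx) (hL _ _ hzy)]

theorem LF_subd {V : Type} {J : SimpleGraph V} {L : SimpleGraph (Option V)} {S : Set V}
    {u v : V} (huv : J.Adj u v) (h : LF J S)
    (hL : ∀ x y, L.Adj (some x) (some y) → J.Adj x y ∧ s(x, y) ≠ s(u, v))
    (hN : ∀ x, L.Adj none (some x) → x = u ∨ x = v) :
    LF L (some '' S) := by
  intro T hT hd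
  by_cases hT' : (some ⁻¹' T).Nonempty
  · by_cases hn : none ∈ T ∧ ¬ (some u ∈ T ∧ some v ∈ T)
    · obtain ⟨hn, hh⟩ := hn
      refine ⟨none, hn, ?_⟩
      rintro (_ | x) hx (_ | y) hy hzx hzy
      · rfl
      · exact absurd hzx (L.loopless.irrefl _)
      · exact absurd hzy (L.loopless.irrefl _)
      · rcases hN _ hzx with rfl | rfl <;> rcases hN _ hzy with rfl | rfl <;> tauto
    · obtain ⟨z, hzT, hz⟩ := h (some ⁻¹' T) hT' (fun t ht hS => hd _ ht ⟨t, hS, rfl⟩)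
      refine ⟨some z, hzT, ?_⟩
      have aux : none ∈ T → L.Adj (some z) none → ∀ y, some y ∈ T → ¬ L.Adj (some z) (some y) := by
        intro hnT hzn y hy hzy
        have huvT : some u ∈ T ∧ some v ∈ T := by tauto
        obtain ⟨h1, h2⟩ := hL _ _ hzy
        rcases hN _ hzn.symm with rfl | rfl
        · exact h2 (by rw [hz y hy v huvT.2 h1 huv])
        · exact h2 (by rw [hz y hy u huvT.1 h1 huv.symm, Sym2.eq_swap])
      rintro (_ | x) hx (_ | y) hy hzx hzy
      · rfl
      · exact absurd hzy (aux hx hzx y hy)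
      · exact absurd hzx (aux hy hzy x hx)
      · rw [hz x hx y hy (hL _ _ hzx).1 (hL _ _ hzy).1]
  · obtain ⟨(_ | t), ht⟩ := hT
    · refine ⟨none, ht, ?_⟩
      rintro (_ | x) hx (_ | y) hy hzx hzy
      · rfl
      · exact absurd ⟨y, hy⟩ hT'
      · exact absurd ⟨x, hx⟩ hT'
      · exact absurd ⟨x, hx⟩ hT'
    · exact absurd ⟨t, ht⟩ hT'

def Q0 {V : Type} (n : ℕ) (G : SimpleGraph V) : Prop := ∃ S, LF G S ∧ S.ncard ≤ n

def Q1 {V : Type} (n : ℕ) (G : SimpleGraph V) : Prop :=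
  ∀ u v, G.Adj u v → ∃ S, LF (G.deleteEdges {s(u, v)}) S ∧ S.ncard ≤ n

theorem ncard_some {V : Type} (S : Set V) : (some '' S).ncard = S.ncard :=
  Set.ncard_image_of_injective _ (Option.some_injective _)

theorem ncard_ins {V : Type} (S : Set V) (w : Option V) :
    (insert w (some '' S)).ncard ≤ S.ncard + 1 :=
  (Set.ncard_insert_le _ _).trans (by rw [ncard_some])

theorem sub_ss {V : Type} (J : SimpleGraph V) (u v x y : V) :
    (subdivide J u v).Adj (some x) (some y) ↔ J.Adj x y ∧ s(x, y) ≠ s(u, v) := by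
  simp only [subdivide, SimpleGraph.fromRel_adj]
  constructor
  · rintro ⟨_, h | ⟨h1, h2⟩⟩
    · exact h
    · exact ⟨h1.symm, by rwa [Sym2.eq_swap]⟩
  · rintro h
    exact ⟨fun hh => h.1.ne (Option.some_injective _ hh), Or.inl h⟩

theorem sub_ns {V : Type} (J : SimpleGraph V) (u v x : V) :
    (subdivide J u v).Adj none (some x) ↔ x = u ∨ x = v := by
  simp [subdivide, SimpleGraph.fromRel_adj]

theorem apex_ss {V : Type} (J : SimpleGraph V) (A : Set V) (x y : V) :
    (addApex J A).Adj (some x) (some y) ↔ J.Adj x y := by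
  simp only [addApex, SimpleGraph.fromRel_adj]
  constructor
  · rintro ⟨_, h | h⟩
    · exact h
    · exact h.symm
  · rintro h
    exact ⟨fun hh => h.ne (Option.some_injective _ hh), Or.inl h⟩

theorem apex_ns {V : Type} (J : SimpleGraph V) (A : Set V) (x : V) :
    (addApex J A).Adj none (some x) ↔ x ∈ A := by
  simp [addApex, SimpleGraph.fromRel_adj]

theorem Q0_subd {V : Type} {J : SimpleGraph V} {u v : V} {n : ℕ} (huv : J.Adj u v)
    (h : Q0 n J) : Q0 n (subdivide J u v) := by
  obtain ⟨S, hS, hn⟩ := h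
  exact ⟨some '' S, LF_subd huv hS (fun x y => (sub_ss J u v x y).1)
    (fun x => (sub_ns J u v x).1), by rwa [ncard_some]⟩

theorem Q1_half {V : Type} {J : SimpleGraph V} {u v x : V} {n : ℕ} (huv : J.Adj u v)
    (h : Q1 n J) (hx : x = u ∨ x = v) :
    ∃ S, LF ((subdivide J u v).deleteEdges {s(none, some x)}) S ∧ S.ncard ≤ n := by
  obtain ⟨S, hS, hn⟩ := h u v huv
  refine ⟨some '' S, LF_pendant hS ?_ ?_, by rwa [ncard_some]⟩
  · intro a b hab
    rw [deleteEdges_adj, sub_ss] at hab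
    rw [deleteEdges_adj]
    exact hab.1
  · intro a b _ _ ha hb
    rw [deleteEdges_adj, sub_ns] at ha hb
    obtain ⟨ha, ha'⟩ := ha
    obtain ⟨hb, hb'⟩ := hb
    have ha2 : a ≠ x := by rintro rfl; exact ha' rfl
    have hb2 : b ≠ x := by rintro rfl; exact hb' rfl
    grind

theorem Q1_subd {V : Type} {J : SimpleGraph V} {u v : V} {n : ℕ} (huv : J.Adj u v)
    (h : Q1 n J) : Q1 n (subdivide J u v) := by
  rintro (_ | x) (_ | y) hxy
  · exact absurd hxy (SimpleGraph.irrefl _)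
  · exact Q1_half huv h ((sub_ns J u v y).1 hxy)
  · rw [Sym2.eq_swap]
    exact Q1_half huv h ((sub_ns J u v x).1 hxy.symm)
  · obtain ⟨hxy, hne⟩ := (sub_ss J u v x y).1 hxy
    obtain ⟨S, hS, hn⟩ := h x y hxy
    refine ⟨some '' S, LF_subd (u := u) (v := v) ?_ hS ?_ ?_, by rwa [ncard_some]⟩
    · rw [deleteEdges_adj]
      exact ⟨huv, fun hh => hne hh.symm⟩
    · intro a b hab
      rw [deleteEdges_adj, sub_ss] at hab
      rw [deleteEdges_adj]
      refine ⟨⟨hab.1.1, fun hh => hab.2 ?_⟩, hab.1.2⟩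
      have hh' : s(a, b) = s(x, y) := hh
      have := congrArg (Sym2.map some) hh'
      exact this
    · intro a ha
      rw [deleteEdges_adj, sub_ns] at ha
      exact ha.1

theorem Q0_apex {V : Type} {J : SimpleGraph V} {A : Set V} {n : ℕ}
    (h : Q0 n J) : Q0 (n + 1) (addApex J A) := by
  obtain ⟨S, hS, hn⟩ := h
  exact ⟨_, LF_insert hS (fun x y => (apex_ss J A x y).1),
    (ncard_ins S none).trans (Nat.succ_le_succ hn)⟩

/-- the apex becomes pendant -/
theorem Q1_apexedge {V : Type} {K : SimpleGraph V} {A : Set V} {S : Set V} {t : V}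
    (h : LF K S) (hp : ∀ x y, x ∈ A → y ∈ A → x ∉ S → y ∉ S → x ≠ t → y ≠ t → x = y) :
    LF ((addApex K A).deleteEdges {s(none, some t)}) (some '' S) := by
  refine LF_pendant h ?_ ?_
  · intro a b hab
    rw [deleteEdges_adj, apex_ss] at hab
    exact hab.1
  · intro a b hSa hSb ha hb
    rw [deleteEdges_adj, apex_ns] at ha hb
    obtain ⟨ha, ha'⟩ := ha
    obtain ⟨hb, hb'⟩ := hb
    exact hp a b ha hb hSa hSb (by rintro rfl; exact ha' rfl) (by rintro rfl; exact hb' rfl)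

theorem Q1_circ {V : Type} {H : SimpleGraph V} {x y : V} {u v : Option V} {a : V} {n : ℕ}
    (hxy : H.Adj x y) (huv : (subdivide H x y).Adj u v) (h : Q1 n H) :
    Q1 (n + 1) (addApex (subdivide (subdivide H x y) u v)
      {some (some a), some none, none}) := by
  have hJ := Q1_subd hxy h
  have hK := Q1_subd huv hJ
  have main : ∀ t, t ∈ ({some (some a), some none, none} : Set (Option (Option V))) →
      ∃ S, LF ((addApex (subdivide (subdivide H x y) u v)
        {some (some a), some none, none}).deleteEdges {s(none, some t)}) S ∧
        S.ncard ≤ n + 1 := by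
    intro t ht
    by_cases htn : t = none
    · obtain ⟨S, hS, hn⟩ := h x y hxy
      have h1 : LF (subdivide H x y) (insert none (some '' S)) := by
        refine LF_insert hS (fun b c hbc => ?_)
        rw [sub_ss] at hbc
        rw [deleteEdges_adj]
        exact hbc
      have h2 := LF_subd huv h1 (fun b c => (sub_ss (subdivide H x y) u v b c).1)
        (fun b => (sub_ns (subdivide H x y) u v b).1)
      refine ⟨_, Q1_apexedge h2 ?_, ?_⟩
      · subst htn
        intro b c hb hc hbS hcS hbt hct
        have : some none ∈ some '' (insert none (some '' S)) := ⟨none, by simp, rfl⟩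
        simp only [Set.mem_insert_iff, Set.mem_singleton_iff] at hb hc
        grind
      · rw [ncard_some, ncard_some]
        exact (ncard_ins S none).trans (by omega)
    · obtain ⟨S, hS, hn⟩ := hJ u v huv
      have h1 : LF (subdivide (subdivide H x y) u v) (insert none (some '' S)) := by
        refine LF_insert hS (fun b c hbc => ?_)
        rw [sub_ss] at hbc
        rw [deleteEdges_adj]
        exact hbc
      refine ⟨_, Q1_apexedge h1 ?_, ?_⟩
      · intro b c hb hc hbS hcS hbt hct
        have hb0 : b ≠ none := by rintro rfl; exact hbS (Set.mem_insert _ _)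
        have hc0 : c ≠ none := by rintro rfl; exact hcS (Set.mem_insert _ _)
        simp only [Set.mem_insert_iff, Set.mem_singleton_iff] at hb hc ht
        grind
      · rw [ncard_some]
        exact (ncard_ins S none).trans (by omega)
  rintro (_ | b) (_ | c) hbc
  · exact absurd hbc (SimpleGraph.irrefl _)
  · exact main c ((apex_ns _ _ c).1 hbc)
  · rw [Sym2.eq_swap]
    exact main b ((apex_ns _ _ b).1 hbc.symm)
  · rw [apex_ss] at hbc
    obtain ⟨S, hS, hn⟩ := hK b c hbc
    refine ⟨_, LF_insert hS ?_, (ncard_ins S none).trans (by omega)⟩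
    intro d e hde
    rw [deleteEdges_adj, apex_ss] at hde
    rw [deleteEdges_adj]
    refine ⟨hde.1, fun hh => hde.2 ?_⟩
    have hh' : s(d, e) = s(b, c) := hh
    exact congrArg (Sym2.map some) hh'

theorem ncard_preim {V W : Type} (f : V ≃ W) (S : Set W) : (f ⁻¹' S).ncard = S.ncard := by
  rw [← Equiv.image_symm_eq_preimage, Set.ncard_image_of_injective _ f.symm.injective]

theorem Q0_iso {V W : Type} {G : SimpleGraph V} {K : SimpleGraph W} (f : G ≃g K) {n : ℕ}
    (h : Q0 n K) : Q0 n G := by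
  obtain ⟨S, hS, hn⟩ := h
  exact ⟨_, LF_iso f.toEquiv (fun x y hxy => f.map_adj_iff.2 hxy) hS, by rwa [ncard_preim]⟩

theorem Q1_iso {V W : Type} {G : SimpleGraph V} {K : SimpleGraph W} (f : G ≃g K) {n : ℕ}
    (h : Q1 n K) : Q1 n G := by
  intro u v huv
  obtain ⟨S, hS, hn⟩ := h (f u) (f v) (f.map_adj_iff.2 huv)
  refine ⟨_, LF_iso f.toEquiv (fun x y hxy => ?_) hS, by rwa [ncard_preim]⟩
  rw [deleteEdges_adj] at hxy ⊢
  refine ⟨f.map_adj_iff.2 hxy.1, fun hh => hxy.2 ?_⟩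
  have hh' : Sym2.map f s(x, y) = Sym2.map f s(u, v) := hh
  exact Sym2.map.injective f.injective hh'

theorem exists_LF {V : Type} [Finite V] (G : SimpleGraph V) :
    ∃ S, LF G S ∧ S.ncard = fvs G := by
  have hne : {n : ℕ | ∃ S : Set V, IsFVS G S ∧ S.ncard = n}.Nonempty := by
    refine ⟨_, Set.univ, isFVS_of_LF ?_, rfl⟩
    rintro T ⟨t, ht⟩ hd
    exact absurd (Set.mem_univ t) (hd t ht)
  obtain ⟨S, hS, hn⟩ := Nat.sInf_mem hne
  exact ⟨S, LF_of_isFVS hS, hn⟩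

theorem fvs_le {V : Type} {G : SimpleGraph V} {S : Set V} (h : LF G S) : fvs G ≤ S.ncard :=
  Nat.sInf_le ⟨S, isFVS_of_LF h, rfl⟩

/-- the `∘` operation raises by at most one the upper bounds on the
feedback vertex number under deletion of `k ∈ {0,1}` edges. -/
theorem statement7 {V W : Type} [Fintype V] [Fintype W] (H : SimpleGraph V)
    (e1 e2 : Sym2 V) (he1 : e1 ∈ H.edgeSet) (he2 : e2 ∈ H.edgeSet)
    (a : V) (ha : (H.neighborSet a).ncard = 2)
    (G : SimpleGraph W) (hG : IsCircOp H e1 e2 a G)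
    (k : ℕ) (hk : k = 0 ∨ k = 1) (p : ℝ)
    (hH : ∀ Ws : Set (Sym2 V), Ws ⊆ H.edgeSet → Ws.ncard = k →
      (fvs (H.deleteEdges Ws) : ℝ) ≤ p) :
    ∀ W' : Set (Sym2 W), W' ⊆ G.edgeSet → W'.ncard = k →
      (fvs (G.deleteEdges W') : ℝ) ≤ p + 1 := by
  have main : ∃ (x y : V) (u v : Option V), H.Adj x y ∧ (subdivide H x y).Adj u v ∧
      Nonempty (G ≃g addApex (subdivide (subdivide H x y) u v)
        {some (some a), some none, none}) := by
    rcases hG with ⟨hne, x1, y1, x2, y2, rfl, rfl, hf⟩ | ⟨rfl, x, y, rfl, hf⟩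
    · exact ⟨x1, y1, _, _, he1, (sub_ss _ _ _ _ _).2 ⟨he2, fun hh => hne hh.symm⟩, hf⟩
    · exact ⟨x, y, _, _, he1, (sub_ns _ _ _ _).2 (Or.inr rfl), hf⟩
  obtain ⟨x, y, u, v, hxy, huv, ⟨f⟩⟩ := main
  have hp : 0 ≤ p := by
    rcases hk with rfl | rfl
    · exact (Nat.cast_nonneg _).trans (hH ∅ (Set.empty_subset _) (by simp))
    · exact (Nat.cast_nonneg _).trans
        (hH {s(x, y)} (Set.singleton_subset_iff.2 hxy) (by simp))
  have fin : ∀ m : ℕ, m ≤ ⌊p⌋₊ + 1 → (m : ℝ) ≤ p + 1 := by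
    intro m hm
    have h1 : (m : ℝ) ≤ (⌊p⌋₊ : ℝ) + 1 := by exact_mod_cast hm
    have h2 := Nat.floor_le hp
    linarith
  intro W' hW' hcard
  apply fin
  rcases hk with rfl | rfl
  · have h0 : Q0 ⌊p⌋₊ H := by
      have h1 := hH ∅ (Set.empty_subset _) (by simp)
      rw [deleteEdges_empty] at h1
      obtain ⟨S, hS, hn⟩ := exists_LF H
      exact ⟨S, hS, hn ▸ Nat.le_floor h1⟩
    obtain ⟨S, hS, hn⟩ := Q0_iso f (Q0_apex (Q0_subd huv (Q0_subd hxy h0)))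
    rw [Set.ncard_eq_zero] at hcard
    subst hcard
    rw [deleteEdges_empty]
    exact (fvs_le hS).trans hn
  · have h0 : Q1 ⌊p⌋₊ H := by
      intro b c hbc
      have h1 := hH {s(b, c)} (Set.singleton_subset_iff.2 hbc) (by simp)
      obtain ⟨S, hS, hn⟩ := exists_LF (H.deleteEdges {s(b, c)})
      exact ⟨S, hS, hn ▸ Nat.le_floor h1⟩
    obtain ⟨e, rfl⟩ := Set.ncard_eq_one.1 hcard
    induction e with | _ b c =>
    obtain ⟨S, hS, hn⟩ := Q1_iso f (Q1_circ (a := a) hxy huv h0) b c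
      (G.mem_edgeSet.1 (hW' (Set.mem_singleton _)))
    exact (fvs_le hS).trans hn

end InducedForest
end

section
/- If G is a member of F_{4,j} (for some 0 ≤ j ≤ 4) with girth at least 5, then j ≥ 2. Moreover, up to isomorphism, R is the unique member of F_{4,2} with girth at least 5. -/
open SimpleGraph

namespace InducedForest

/-! ### A computable model: graphs as edge lists on initial segments of the naturals -/

def pairEq (p : ℕ × ℕ) (a b : ℕ) : Bool :=
  (Nat.beq p.1 a && Nat.beq p.2 b) || (Nat.beq p.1 b && Nat.beq p.2 a)

def adjL (L : List (ℕ × ℕ)) (a b : ℕ) : Bool := L.any (fun p => pairEq p a b)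

def subL (L : List (ℕ × ℕ)) (n a b : ℕ) : List (ℕ × ℕ) :=
  (a, n) :: (b, n) :: L.filter (fun p => !pairEq p a b)

def nbL (L : List (ℕ × ℕ)) (u : ℕ) : List ℕ :=
  L.filterMap (fun p => bif Nat.beq p.1 u then some p.2 else
    bif Nat.beq p.2 u then some p.1 else none)

/-- Search for a cycle of length at most 4 (no correctness needed). -/
def findShort (L : List (ℕ × ℕ)) : List ℕ :=
  (L.findSome? (fun p =>
    (nbL L p.1).findSome? (fun x => bif Nat.beq x p.2 then none else
      (nbL L p.2).findSome? (fun y => bif Nat.beq y p.1 then none else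
        bif Nat.beq x y then some [p.1, p.2, x] else
        bif adjL L x y then some [p.1, p.2, y, x] else none)))).getD []

/-- Check that a list of vertices is a cycle of length 3 or 4. -/
def certC (n : ℕ) (L : List (ℕ × ℕ)) : List ℕ → Bool
  | [a, b, c] => Nat.blt a n && Nat.blt b n && Nat.blt c n &&
      adjL L a b && adjL L b c && adjL L c a
  | [a, b, c, d] => Nat.blt a n && Nat.blt b n && Nat.blt c n && Nat.blt d n &&
      adjL L a b && adjL L b c && adjL L c d && adjL L d a && !Nat.beq a c && !Nat.beq b d
  | _ => false

def comL (L : List (ℕ × ℕ)) (u v : ℕ) : ℕ :=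
  ((nbL L u).find? (fun x => adjL L v x)).getD 0

/-- Edge list of `R`; the vertex `(i, s)` is coded as `i + 5 s`. -/
def RL : List (ℕ × ℕ) :=
  [(1, 2), (2, 3), (3, 4), (4, 0), (5, 7), (6, 8), (7, 9), (8, 5), (9, 6),
    (0, 5), (1, 6), (2, 7), (3, 8), (4, 9)]

def isoList (L : List (ℕ × ℕ)) : List ℕ :=
  match nbL L 8, nbL L 9 with
  | [a, b], [c, d] => [8, 9, c, comL L a c, a, b, d, comL L b c, comL L b d, comL L a d]
  | _, _ => []

def checkIso (L : List (ℕ × ℕ)) (q : List ℕ) : Bool :=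
  (List.range 10).all (fun i => Nat.blt (q.getD i 10) 10 &&
    (List.range 10).all (fun j =>
      (Nat.beq i j || !Nat.beq (q.getD i 10) (q.getD j 10)) &&
      (adjL RL i j == adjL L (q.getD i 10) (q.getD j 10))))

def K4L : List (ℕ × ℕ) := [(0, 1), (0, 2), (0, 3), (1, 2), (1, 3), (2, 3)]

def apexL (L : List (ℕ × ℕ)) (n a b c : ℕ) : List (ℕ × ℕ) :=
  (a, n) :: (b, n) :: (c, n) :: L

def check41 : Bool :=
  (subL K4L 4 0 1).all (fun e1 =>
    (subL (subL K4L 4 0 1) 5 e1.1 e1.2).all (fun e2 =>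
      certC 7 (subL (subL (subL K4L 4 0 1) 5 e1.1 e1.2) 6 e2.1 e2.2)
        (findShort (subL (subL (subL K4L 4 0 1) 5 e1.1 e1.2) 6 e2.1 e2.2))))

def allShort (L : List (ℕ × ℕ)) : List (List ℕ) :=
  L.flatMap (fun p =>
    (nbL L p.1).flatMap (fun x => bif Nat.beq x p.2 then [] else
      (nbL L p.2).filterMap (fun y => bif Nat.beq y p.1 then none else
        bif Nat.beq x y then some [p.1, p.2, x] else
        bif adjL L x y then some [p.1, p.2, y, x] else none)))

/-- Does the cycle use the edge `p`? -/
def hitC (p : ℕ × ℕ) : List ℕ → Bool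
  | [a, b, c] => pairEq p a b || pairEq p b c || pairEq p c a
  | [a, b, c, d] => pairEq p a b || pairEq p b c || pairEq p c d || pairEq p d a
  | _ => true

def check42d (L : List (ℕ × ℕ)) : Bool :=
  certC 10 L (findShort L) || checkIso L (isoList L)

def check42c (cs : List (List ℕ)) (L : List (ℕ × ℕ)) : Bool :=
  L.all (fun e => cs.any (fun c => !hitC e c) || check42d (subL L 9 e.1 e.2))

def check42b' (cs : List (List ℕ)) (L : List (ℕ × ℕ)) : Bool :=
  L.all (fun e => check42c (cs.filter (fun c => !hitC e c)) (subL L 8 e.1 e.2))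

def check42b (L : List (ℕ × ℕ)) : Bool :=
  check42b' ((allShort L).filter (certC 8 L)) L

def check42a (L : List (ℕ × ℕ)) : Bool :=
  L.all (fun e => check42b (apexL (subL L 6 e.1 e.2) 7 4 5 6))

def check42 : Bool :=
  (subL K4L 4 0 1).all (fun e => check42a (subL (subL K4L 4 0 1) 5 e.1 e.2))

theorem check41_true : check41 = true := by decide +kernel

theorem check42_true : check42 = true := by decide +kernel

theorem pairEq_iff (p : ℕ × ℕ) (a b : ℕ) :
    pairEq p a b = true ↔ (p.1 = a ∧ p.2 = b) ∨ (p.1 = b ∧ p.2 = a) := by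
  simp [pairEq]

theorem adjL_iff (L : List (ℕ × ℕ)) (a b : ℕ) :
    adjL L a b = true ↔ (a, b) ∈ L ∨ (b, a) ∈ L := by
  simp only [adjL, List.any_eq_true, pairEq_iff]
  constructor
  · rintro ⟨⟨x, y⟩, h, h' | h'⟩ <;> simp_all
  · rintro (h | h)
    · exact ⟨_, h, Or.inl ⟨rfl, rfl⟩⟩
    · exact ⟨_, h, Or.inr ⟨rfl, rfl⟩⟩

structure RepF {V : Type} (f : V → ℕ) (G : SimpleGraph V) (n : ℕ) (L : List (ℕ × ℕ)) : Prop where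
  inj : Function.Injective f
  lt : ∀ v, f v < n
  surj : ∀ i < n, ∃ v, f v = i
  adj : ∀ u v, G.Adj u v ↔ adjL L (f u) (f v) = true
  bd : ∀ p ∈ L, p.1 < n ∧ p.2 < n

def ext {V : Type} (f : V → ℕ) (n : ℕ) : Option V → ℕ
  | some v => f v
  | none => n

theorem ext_inj {V : Type} {f : V → ℕ} {n : ℕ} (hi : Function.Injective f) (hl : ∀ v, f v < n) :
    Function.Injective (ext f n) := by
  rintro (_ | u) (_ | v) h
  · rfl
  · exact absurd h (hl v).ne'
  · exact absurd h (hl u).ne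
  · exact congrArg some (hi h)

theorem ext_lt {V : Type} {f : V → ℕ} {n : ℕ} (hl : ∀ v, f v < n) (v : Option V) :
    ext f n v < n + 1 := by
  cases v with
  | none => exact Nat.lt_succ_self n
  | some v => exact Nat.lt_succ_of_lt (hl v)

theorem ext_surj {V : Type} {f : V → ℕ} {n : ℕ} (hs : ∀ i < n, ∃ v, f v = i) :
    ∀ i < n + 1, ∃ v, ext f n v = i := by
  intro i hi
  rcases Nat.lt_succ_iff_lt_or_eq.mp hi with h | h
  · obtain ⟨v, hv⟩ := hs i h
    exact ⟨some v, hv⟩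
  · exact ⟨none, h.symm⟩

theorem adjL_symm (L : List (ℕ × ℕ)) (a b : ℕ) : adjL L a b = true ↔ adjL L b a = true := by
  rw [adjL_iff, adjL_iff, or_comm]

theorem adjL_sub (L : List (ℕ × ℕ)) (n a b i j : ℕ) (hi : i < n) (hj : j < n) :
    adjL (subL L n a b) i j = true ↔ adjL L i j = true ∧ pairEq (a, b) i j = false := by
  rw [Bool.eq_false_iff, Ne, pairEq_iff, adjL_iff, adjL_iff]
  simp only [subL, List.mem_cons, List.mem_filter, Prod.mk.injEq, Bool.not_eq_true',
    Bool.eq_false_iff, Ne, pairEq_iff]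
  constructor
  · rintro ((h | h | h) | (h | h | h))
    all_goals first
      | omega
      | exact ⟨Or.inl h.1, by have := h.2; omega⟩
      | exact ⟨Or.inr h.1, by have := h.2; omega⟩
  · rintro ⟨h | h, h'⟩
    · exact Or.inl (Or.inr (Or.inr ⟨h, by omega⟩))
    · exact Or.inr (Or.inr (Or.inr ⟨h, by omega⟩))

theorem sub_rep {V : Type} {f : V → ℕ} {G : SimpleGraph V} {n : ℕ} {L : List (ℕ × ℕ)}
    (h : RepF f G n L) (x y : V) :
    RepF (ext f n) (subdivide G x y) (n + 1) (subL L n (f x) (f y)) := by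
  refine ⟨ext_inj h.inj h.lt, ext_lt h.lt, ext_surj h.surj, ?_, ?_⟩
  swap
  · intro p hp
    simp only [subL, List.mem_cons, List.mem_filter] at hp
    have hx := h.lt x
    have hy := h.lt y
    rcases hp with rfl | rfl | hp
    · exact ⟨by simp only; omega, by simp only; omega⟩
    · exact ⟨by simp only; omega, by simp only; omega⟩
    · have := h.bd _ hp.1
      exact ⟨by omega, by omega⟩
  have hL := h.bd
  have key : ∀ u, adjL (subL L n (f x) (f y)) (f u) n = true ↔ u = x ∨ u = y := by
    intro u
    rw [adjL_iff]
    simp only [subL, List.mem_cons, List.mem_filter, Prod.mk.injEq]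
    have hu := h.lt u
    have hx := h.lt x
    have hy := h.lt y
    constructor
    · rintro ((h1 | h1 | h1) | (h1 | h1 | h1))
      · exact Or.inl (h.inj h1.1)
      · exact Or.inr (h.inj h1.1)
      · exact absurd (hL _ h1.1).2 (lt_irrefl _)
      · omega
      · omega
      · exact absurd (hL _ h1.1).1 (lt_irrefl _)
    · rintro (rfl | rfl) <;> simp
  rintro (_ | u) (_ | v)
  · simp only [SimpleGraph.irrefl, ext, false_iff, Bool.not_eq_true]
    rw [Bool.eq_false_iff, Ne, adjL_iff]
    simp only [subL, List.mem_cons, List.mem_filter, Prod.mk.injEq]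
    have hx := h.lt x
    have hy := h.lt y
    rintro ((h1 | h1 | h1) | (h1 | h1 | h1))
    all_goals first
      | omega
      | exact absurd (hL _ h1.1).1 (lt_irrefl _)
  · simp only [ext]
    rw [adjL_symm, key]
    simp [subdivide]
  · simp only [ext]
    rw [key]
    simp [subdivide]
  · simp only [ext]
    rw [adjL_sub _ _ _ _ _ _ (h.lt u) (h.lt v), ← h.adj, Bool.eq_false_iff, Ne, pairEq_iff]
    simp only [h.inj.eq_iff]
    simp only [subdivide, SimpleGraph.fromRel_adj, ne_eq, Option.some.injEq, Sym2.eq_iff]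
    have hs := G.adj_comm u v
    have hn : G.Adj u v → u ≠ v := fun h => h.ne
    constructor
    · rintro ⟨_, h1 | h1⟩
      · exact ⟨h1.1, by rintro (⟨rfl, rfl⟩ | ⟨rfl, rfl⟩) <;> simp at h1⟩
      · exact ⟨h1.1.symm, by rintro (⟨rfl, rfl⟩ | ⟨rfl, rfl⟩) <;> simp at h1⟩
    · rintro ⟨h1, h2⟩
      exact ⟨hn h1, Or.inl ⟨h1, by rintro (⟨rfl, rfl⟩ | ⟨rfl, rfl⟩) <;> simp at h2⟩⟩

theorem subdivide_comm {V : Type} (G : SimpleGraph V) (x y : V) :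
    subdivide G x y = subdivide G y x := by
  ext u v
  rcases u with _ | u <;> rcases v with _ | v <;>
    simp [subdivide, Sym2.eq_swap (a := x) (b := y), or_comm]

theorem step {V : Type} {f : V → ℕ} {G : SimpleGraph V} {n : ℕ} {L : List (ℕ × ℕ)}
    (h : RepF f G n L) {x y : V} (hxy : G.Adj x y) :
    ∃ p ∈ L, RepF (ext f n) (subdivide G x y) (n + 1) (subL L n p.1 p.2) := by
  rcases (adjL_iff _ _ _).1 ((h.adj x y).1 hxy) with h1 | h1
  · exact ⟨_, h1, sub_rep h x y⟩
  · exact ⟨_, h1, by rw [subdivide_comm]; exact sub_rep h y x⟩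

theorem apex_rep {V : Type} {f : V → ℕ} {G : SimpleGraph V} {n : ℕ} {L : List (ℕ × ℕ)}
    (h : RepF f G n L) (a b c : V) :
    RepF (ext f n) (addApex G {a, b, c}) (n + 1) (apexL L n (f a) (f b) (f c)) := by
  have ha := h.lt a
  have hb := h.lt b
  have hc := h.lt c
  have key : ∀ u, adjL (apexL L n (f a) (f b) (f c)) (f u) n = true ↔ u = a ∨ u = b ∨ u = c := by
    intro u
    rw [adjL_iff]
    simp only [apexL, List.mem_cons, Prod.mk.injEq]
    have hu := h.lt u
    constructor
    · rintro ((h1 | h1 | h1 | h1) | (h1 | h1 | h1 | h1))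
      · exact Or.inl (h.inj h1.1)
      · exact Or.inr (Or.inl (h.inj h1.1))
      · exact Or.inr (Or.inr (h.inj h1.1))
      · exact absurd (h.bd _ h1).2 (lt_irrefl _)
      · omega
      · omega
      · omega
      · exact absurd (h.bd _ h1).1 (lt_irrefl _)
    · rintro (rfl | rfl | rfl) <;> simp
  refine ⟨ext_inj h.inj h.lt, ext_lt h.lt, ext_surj h.surj, ?_, ?_⟩
  · rintro (_ | u) (_ | v)
    · simp only [SimpleGraph.irrefl, ext, false_iff, Bool.not_eq_true]
      rw [Bool.eq_false_iff, Ne, adjL_iff]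
      simp only [apexL, List.mem_cons, Prod.mk.injEq]
      rintro ((h1 | h1 | h1 | h1) | (h1 | h1 | h1 | h1))
      all_goals first
        | omega
        | exact absurd (h.bd _ h1).1 (lt_irrefl _)
    · simp only [ext]
      rw [adjL_symm, key]
      simp [addApex]
    · simp only [ext]
      rw [key]
      simp [addApex]
    · have hu := h.lt u
      have hv := h.lt v
      have : adjL (apexL L n (f a) (f b) (f c)) (f u) (f v) = true ↔
          adjL L (f u) (f v) = true := by
        rw [adjL_iff, adjL_iff]
        simp only [apexL, List.mem_cons, Prod.mk.injEq]
        constructor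
        · rintro ((h1 | h1 | h1 | h1) | (h1 | h1 | h1 | h1))
          all_goals first
            | omega
            | exact Or.inl h1
            | exact Or.inr h1
        · rintro (h1 | h1)
          · exact Or.inl (Or.inr (Or.inr (Or.inr h1)))
          · exact Or.inr (Or.inr (Or.inr (Or.inr h1)))
      simp only [ext]
      rw [this, ← h.adj]
      simp only [addApex, SimpleGraph.fromRel_adj, ne_eq, Option.some.injEq]
      constructor
      · rintro ⟨_, h1 | h1⟩
        · exact h1
        · exact h1.symm
      · intro h1
        exact ⟨h1.ne, Or.inl h1⟩
  · intro p hp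
    simp only [apexL, List.mem_cons] at hp
    rcases hp with rfl | rfl | rfl | hp
    · exact ⟨by simp only; omega, by simp only; omega⟩
    · exact ⟨by simp only; omega, by simp only; omega⟩
    · exact ⟨by simp only; omega, by simp only; omega⟩
    · have := h.bd _ hp
      exact ⟨by omega, by omega⟩

theorem RepF.iso {V W : Type} {f : V → ℕ} {G : SimpleGraph V} {n : ℕ} {L : List (ℕ × ℕ)}
    (h : RepF f G n L) {G' : SimpleGraph W} (φ : G' ≃g G) : RepF (f ∘ φ) G' n L := by
  refine ⟨h.inj.comp φ.injective, fun v => h.lt _, ?_, ?_, h.bd⟩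
  · intro i hi
    obtain ⟨v, hv⟩ := h.surj i hi
    exact ⟨φ.symm v, by simp [hv]⟩
  · intro u v
    rw [← φ.map_adj_iff, h.adj]
    rfl

theorem iso_of_rep {V W : Type} {f : V → ℕ} {G : SimpleGraph V} {n : ℕ} {L : List (ℕ × ℕ)}
    (h : RepF f G n L) {f' : W → ℕ} {G' : SimpleGraph W} {L' : List (ℕ × ℕ)}
    (h' : RepF f' G' n L') (q : ℕ → ℕ) (hq : ∀ i < n, q i < n)
    (hi : ∀ i < n, ∀ j < n, q i = q j → i = j)
    (ha : ∀ i < n, ∀ j < n, adjL L' i j = adjL L (q i) (q j)) : Nonempty (G' ≃g G) := by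
  have hex : ∀ w, ∃ v, f v = q (f' w) := fun w => h.surj _ (hq _ (h'.lt w))
  choose g hg using hex
  have ginj : Function.Injective g := by
    intro a b hab
    apply h'.inj
    apply hi _ (h'.lt _) _ (h'.lt _)
    rw [← hg, ← hg, hab]
  have gsurj : Function.Surjective g := by
    intro v
    let Q : Fin n → Fin n := fun i => ⟨q i, hq i i.2⟩
    have hQ : Function.Injective Q := by
      intro a b hab
      exact Fin.ext (hi _ a.2 _ b.2 (by simpa [Q] using hab))
    obtain ⟨i, hQi⟩ := (Finite.injective_iff_surjective.mp hQ) ⟨f v, h.lt v⟩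
    obtain ⟨w, hw⟩ := h'.surj i i.2
    refine ⟨w, h.inj ?_⟩
    rw [hg, hw]
    simpa [Q] using hQi
  refine ⟨⟨Equiv.ofBijective g ⟨ginj, gsurj⟩, ?_⟩⟩
  intro a b
  change G.Adj (g a) (g b) ↔ G'.Adj a b
  rw [h.adj, h'.adj, hg, hg, ha _ (h'.lt a) _ (h'.lt b)]

/-! ### Girth -/

theorem no_triangle {V : Type} {G : SimpleGraph V} (hg : 5 ≤ G.egirth) {a b c : V}
    (hab : G.Adj a b) (hbc : G.Adj b c) (hca : G.Adj c a) : False := by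
  have hc : (Walk.cons hab (Walk.cons hbc (Walk.cons hca Walk.nil))).IsCycle := by
    have h1 := hab.ne
    have h2 := hbc.ne
    have h3 := hca.ne
    rw [Walk.cons_isCycle_iff]
    simp [Walk.cons_isPath_iff]
    grind
  have := le_egirth.1 hg _ _ hc
  simp at this
  exact absurd this (by decide)

theorem no_square {V : Type} {G : SimpleGraph V} (hg : 5 ≤ G.egirth) {a b c d : V}
    (hab : G.Adj a b) (hbc : G.Adj b c) (hcd : G.Adj c d) (hda : G.Adj d a)
    (hac : a ≠ c) (hbd : b ≠ d) : False := by
  have hc : (Walk.cons hab (Walk.cons hbc (Walk.cons hcd (Walk.cons hda Walk.nil)))).IsCycle := by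
    have h1 := hab.ne
    have h2 := hbc.ne
    have h3 := hcd.ne
    have h4 := hda.ne
    rw [Walk.cons_isCycle_iff]
    simp [Walk.cons_isPath_iff]
    grind
  have := le_egirth.1 hg _ _ hc
  simp at this
  exact absurd this (by decide)

theorem egirth_ge {V : Type} {G : SimpleGraph V}
    (h3 : ∀ a b c, G.Adj a b → G.Adj b c → G.Adj c a → False)
    (h4 : ∀ a b c d, G.Adj a b → G.Adj b c → G.Adj c d → G.Adj d a → a ≠ c → b ≠ d → False) :
    5 ≤ G.egirth := by
  rw [le_egirth]
  intro a w hw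
  by_contra hlt
  have h3l := hw.three_le_length
  have hl : w.length < 5 := by
    rw [not_le] at hlt
    exact_mod_cast hlt
  cases w with
  | nil => simp at h3l
  | cons e1 w =>
    cases w with
    | nil => simp at h3l
    | cons e2 w =>
      cases w with
      | nil => simp at h3l
      | cons e3 w =>
        cases w with
        | nil => exact h3 _ _ _ e1 e2 e3
        | cons e4 w =>
          cases w with
          | nil =>
            have hn := hw.support_nodup
            simp at hn
            refine h4 _ _ _ _ e1 e2 e3 e4 ?_ ?_
            · grind
            · grind
          | cons e5 w =>
            simp at hl
            omega

theorem cert_sound {V : Type} {f : V → ℕ} {G : SimpleGraph V} {n : ℕ} {L : List (ℕ × ℕ)}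
    (h : RepF f G n L) (hg : 5 ≤ G.egirth) (c : List ℕ) (hc : certC n L c = true) : False := by
  unfold certC at hc
  split at hc
  · simp only [Bool.and_eq_true, Nat.blt_eq] at hc
    obtain ⟨⟨⟨⟨⟨ha, hb⟩, hc⟩, h1⟩, h2⟩, h3⟩ := hc
    obtain ⟨a, rfl⟩ := h.surj _ ha
    obtain ⟨b, rfl⟩ := h.surj _ hb
    obtain ⟨c, rfl⟩ := h.surj _ hc
    rw [← h.adj] at h1 h2 h3
    exact no_triangle hg h1 h2 h3
  · simp only [Bool.and_eq_true, Nat.blt_eq, Bool.not_eq_true'] at hc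
    obtain ⟨⟨⟨⟨⟨⟨⟨⟨⟨ha, hb⟩, hc⟩, hd⟩, h1⟩, h2⟩, h3⟩, h4⟩, h5⟩, h6⟩ := hc
    obtain ⟨a, rfl⟩ := h.surj _ ha
    obtain ⟨b, rfl⟩ := h.surj _ hb
    obtain ⟨c, rfl⟩ := h.surj _ hc
    obtain ⟨d, rfl⟩ := h.surj _ hd
    rw [← h.adj] at h1 h2 h3 h4
    refine no_square hg h1 h2 h3 h4 ?_ ?_
    · rintro rfl
      simp at h5
    · rintro rfl
      simp at h6
  · exact absurd hc (by simp)

theorem cert_persist {n : ℕ} {L : List (ℕ × ℕ)} {p : ℕ × ℕ} {c : List ℕ}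
    (hc : certC n L c = true) (hp : hitC p c = false) :
    certC (n + 1) (subL L n p.1 p.2) c = true := by
  unfold certC at hc
  split at hc
  · simp only [Bool.and_eq_true, Nat.blt_eq] at hc
    obtain ⟨⟨⟨⟨⟨ha, hb⟩, hc⟩, h1⟩, h2⟩, h3⟩ := hc
    simp only [hitC, Bool.or_eq_false_iff] at hp
    obtain ⟨⟨p1, p2⟩, p3⟩ := hp
    simp only [certC, Bool.and_eq_true, Nat.blt_eq]
    refine ⟨⟨⟨⟨⟨by omega, by omega⟩, by omega⟩, ?_⟩, ?_⟩, ?_⟩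
    · exact (adjL_sub _ _ _ _ _ _ ha hb).2 ⟨h1, p1⟩
    · exact (adjL_sub _ _ _ _ _ _ hb hc).2 ⟨h2, p2⟩
    · exact (adjL_sub _ _ _ _ _ _ hc ha).2 ⟨h3, p3⟩
  · simp only [Bool.and_eq_true, Nat.blt_eq] at hc
    obtain ⟨⟨⟨⟨⟨⟨⟨⟨⟨ha, hb⟩, hc⟩, hd⟩, h1⟩, h2⟩, h3⟩, h4⟩, h5⟩, h6⟩ := hc
    simp only [hitC, Bool.or_eq_false_iff] at hp
    obtain ⟨⟨⟨p1, p2⟩, p3⟩, p4⟩ := hp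
    simp only [certC, Bool.and_eq_true, Nat.blt_eq]
    refine ⟨⟨⟨⟨⟨⟨⟨⟨⟨by omega, by omega⟩, by omega⟩, by omega⟩, ?_⟩, ?_⟩, ?_⟩, ?_⟩, h5⟩, h6⟩
    · exact (adjL_sub _ _ _ _ _ _ ha hb).2 ⟨h1, p1⟩
    · exact (adjL_sub _ _ _ _ _ _ hb hc).2 ⟨h2, p2⟩
    · exact (adjL_sub _ _ _ _ _ _ hc hd).2 ⟨h3, p3⟩
    · exact (adjL_sub _ _ _ _ _ _ hd ha).2 ⟨h4, p4⟩
  · exact absurd hc (by simp)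

/-! ### The graph `R` -/

def fR (v : ZMod 5 × Fin 2) : ℕ := v.1.val + 5 * v.2.val

theorem Rgraph_adj (u v : ZMod 5 × Fin 2) : Rgraph.Adj u v ↔
    ((u ≠ v ∧ (((u.2 = 0 ∧ v.2 = 0 ∧ v.1 = u.1 + 1) ∨ (u.2 = 1 ∧ v.2 = 1 ∧ v.1 = u.1 + 2) ∨
      (u.2 = 0 ∧ v.2 = 1 ∧ u.1 = v.1)) ∨ ((v.2 = 0 ∧ u.2 = 0 ∧ u.1 = v.1 + 1) ∨
      (v.2 = 1 ∧ u.2 = 1 ∧ u.1 = v.1 + 2) ∨ (v.2 = 0 ∧ u.2 = 1 ∧ v.1 = u.1)))) ∧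
    ¬ ((u = (0, 0) ∧ v = (1, 0)) ∨ (u = (1, 0) ∧ v = (0, 0)))) := by
  simp only [Rgraph, petersen, SimpleGraph.deleteEdges_adj, SimpleGraph.fromRel_adj,
    Set.mem_singleton_iff, Sym2.eq_iff]

theorem rep_R : RepF fR Rgraph 10 RL := by
  refine ⟨by unfold Function.Injective; decide, by decide, by decide, ?_, by decide⟩
  intro u v
  rw [Rgraph_adj]
  revert u v
  decide +kernel

theorem R_no3 : ∀ a < 10, ∀ b < 10, ∀ c < 10,
    (adjL RL a b && adjL RL b c && adjL RL c a) = false := by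
  decide +kernel

theorem R_no4 : ∀ a < 10, ∀ b < 10, ∀ c < 10, ∀ d < 10,
    (adjL RL a b && (adjL RL b c && (!Nat.beq a c && (adjL RL c d &&
      (adjL RL d a && !Nat.beq b d))))) = false := by
  decide +kernel

theorem R_girth : 5 ≤ Rgraph.egirth := by
  apply egirth_ge
  · intro a b c h1 h2 h3
    rw [rep_R.adj] at h1 h2 h3
    have := R_no3 _ (rep_R.lt a) _ (rep_R.lt b) _ (rep_R.lt c)
    simp [h1, h2, h3] at this
  · intro a b c d h1 h2 h3 h4 h5 h6
    rw [rep_R.adj] at h1 h2 h3 h4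
    have := R_no4 _ (rep_R.lt a) _ (rep_R.lt b) _ (rep_R.lt c) _ (rep_R.lt d)
    simp [h1, h2, h3, h4, rep_R.inj.eq_iff, h5, h6] at this

theorem checkIso_sound {V : Type} {f : V → ℕ} {G : SimpleGraph V} {L : List (ℕ × ℕ)}
    (h : RepF f G 10 L) (q : List ℕ) (hq : checkIso L q = true) : Nonempty (Rgraph ≃g G) := by
  simp only [checkIso, List.all_eq_true, List.mem_range, Bool.and_eq_true, Nat.blt_eq,
    Bool.or_eq_true, Nat.beq_eq, Bool.not_eq_true', beq_iff_eq] at hq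
  refine iso_of_rep h rep_R (fun i => q.getD i 10) (fun i hi => (hq i hi).1) ?_ ?_
  · intro i hi j hj hij
    rcases ((hq i hi).2 j hj).1 with h1 | h1
    · exact h1
    · rw [Bool.eq_false_iff, Ne, Nat.beq_eq] at h1
      exact absurd hij h1
  · intro i hi j hj
    exact ((hq i hi).2 j hj).2

/-! ### The families -/

theorem rep_K4 : RepF (fun v : Fin 4 => v.val) (⊤ : SimpleGraph (Fin 4)) 4 K4L := by
  refine ⟨Fin.val_injective, fun v => v.2, fun i hi => ⟨⟨i, hi⟩, rfl⟩, ?_, by decide⟩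
  simp only [SimpleGraph.top_adj]
  decide

theorem exists_perm : ∀ x y : Fin 4, x ≠ y → ∃ σ : Equiv.Perm (Fin 4), σ x = 0 ∧ σ y = 1 := by
  intro x y hxy
  refine ⟨(Equiv.swap x 0).trans (Equiv.swap (Equiv.swap x 0 y) 1), ?_⟩
  revert x y
  decide

/-- `K_4` with one subdivided edge. -/
theorem K4sub {V : Type} {H : SimpleGraph V} (φ : H ≃g (⊤ : SimpleGraph (Fin 4))) {x y : V}
    (hxy : H.Adj x y) : ∃ f, RepF (ext f 4) (subdivide H x y) 5 (subL K4L 4 0 1) := by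
  obtain ⟨σ, h0, h1⟩ := exists_perm (φ x) (φ y) (φ.injective.ne hxy.ne)
  let τ : (⊤ : SimpleGraph (Fin 4)) ≃g (⊤ : SimpleGraph (Fin 4)) := ⟨σ, by simp⟩
  have h := sub_rep (rep_K4.iso (φ.trans τ)) x y
  have e0 : ((fun v : Fin 4 => v.val) ∘ (φ.trans τ)) x = 0 := by
    show (σ (φ x)).val = 0
    rw [h0]; rfl
  have e1 : ((fun v : Fin 4 => v.val) ∘ (φ.trans τ)) y = 1 := by
    show (σ (φ y)).val = 1
    rw [h1]; rfl
  rw [e0, e1] at h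
  exact ⟨_, h⟩

theorem MemF.le {i j : ℕ} {V : Type} {G : SimpleGraph V} (h : MemF i j G) : j ≤ i := by
  induction h with
  | cycle => omega
  | k4 => omega
  | circ => omega
  | subd _ _ _ _ ih => omega

theorem inv11 {V : Type} {G : SimpleGraph V} (h : MemF 1 1 G) :
    Nonempty (G ≃g (⊤ : SimpleGraph (Fin 4))) := by
  cases h with
  | k4 h => exact h
  | circ hj => omega
  | subd _ hH => exact absurd hH.le (by omega)

theorem inv_subd {i j : ℕ} (hij : j ≤ i) (hj : 1 ≤ j) {V : Type} {G : SimpleGraph V}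
    (h : MemF (i + 1) j G) : ∃ (W : Type) (H : SimpleGraph W) (x y : W),
      MemF i j H ∧ H.Adj x y ∧ Nonempty (G ≃g subdivide H x y) := by
  generalize hk : i + 1 = k at h
  cases h with
  | cycle => omega
  | k4 => omega
  | circ => omega
  | subd _ hH hxy hG =>
    obtain rfl := Nat.succ.inj hk
    exact ⟨_, _, _, _, hH, hxy, hG⟩

theorem step_iso {V W : Type} {f : V → ℕ} {H : SimpleGraph V} {n : ℕ} {L : List (ℕ × ℕ)}
    (h : RepF f H n L) {x y : V} (hxy : H.Adj x y) {G : SimpleGraph W}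
    (hG : Nonempty (G ≃g subdivide H x y)) :
    ∃ p ∈ L, ∃ g, RepF g G (n + 1) (subL L n p.1 p.2) := by
  obtain ⟨p, hp, hr⟩ := step h hxy
  obtain ⟨φ⟩ := hG
  exact ⟨p, hp, _, hr.iso φ⟩

theorem part1 {V : Type} (G : SimpleGraph V) (j : ℕ) (h : MemF 4 j G) (hg : 5 ≤ G.egirth) :
    2 ≤ j := by
  by_contra hj
  have hj' : j = 0 ∨ j = 1 := by omega
  rcases hj' with rfl | rfl
  · cases h with
    | subd hj => omega
    | cycle _ h =>
      obtain ⟨φ⟩ := h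
      have hadj : ∀ u v : ZMod 4, u ≠ v → v = u + 1 → G.Adj (φ.symm u) (φ.symm v) := by
        intro u v h1 h2
        rw [φ.symm.map_adj_iff]
        simp only [cyc, SimpleGraph.fromRel_adj]
        exact ⟨h1, Or.inl h2⟩
      exact no_square hg (hadj 0 1 (by decide) (by decide)) (hadj 1 2 (by decide) (by decide))
        (hadj 2 3 (by decide) (by decide)) (hadj 3 0 (by decide) (by decide))
        (φ.symm.injective.ne (by decide)) (φ.symm.injective.ne (by decide))
  · obtain ⟨_, H3, _, _, h3, a3, i3⟩ := inv_subd (by omega) (by omega) h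
    obtain ⟨_, H2, _, _, h2, a2, i2⟩ := inv_subd (by omega) (by omega) h3
    obtain ⟨_, H1, _, _, h1, a1, ⟨i1⟩⟩ := inv_subd (by omega) (by omega) h2
    obtain ⟨φ⟩ := inv11 h1
    obtain ⟨f, r1⟩ := K4sub φ a1
    obtain ⟨e1, m1, f2, r2⟩ := step_iso (r1.iso i1) a2 i2
    obtain ⟨e2, m2, f3, r3⟩ := step_iso r2 a3 i3
    have hc := check41_true
    simp only [check41, List.all_eq_true] at hc
    exact cert_sound r3 hg _ (hc e1 m1 e2 m2)

theorem inv22 {V : Type} {G : SimpleGraph V} (h : MemF 2 2 G) :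
    ∃ e1 ∈ subL K4L 4 0 1, ∃ e2 ∈ subL (subL K4L 4 0 1) 5 e1.1 e1.2, ∃ f,
      RepF f G 8 (apexL (subL (subL (subL K4L 4 0 1) 5 e1.1 e1.2) 6 e2.1 e2.2) 7 4 5 6) := by
  cases h with
  | subd _ hH => exact absurd hH.le (by omega)
  | @circ _ hj V H hH x y hxy e1 e2 he1 he2 W G hG =>
    obtain ⟨φ⟩ := inv11 hH
    obtain ⟨f, r1⟩ := K4sub φ hxy
    rcases hG with ⟨hne, x1, y1, x2, y2, rfl, rfl, ⟨ψ⟩⟩ | ⟨rfl, x1, y1, rfl, ⟨ψ⟩⟩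
    · obtain ⟨p, hp, r2⟩ := step r1 ((SimpleGraph.mem_edgeSet _).1 he1)
      have ha : (subdivide (subdivide H x y) x1 y1).Adj (some x2) (some y2) := by
        have h2 := (SimpleGraph.mem_edgeSet _).1 he2
        rw [subdivide, SimpleGraph.fromRel_adj]
        exact ⟨by simpa using h2.ne, Or.inl ⟨h2, fun h => hne h.symm⟩⟩
      obtain ⟨p', hp', r3⟩ := step r2 ha
      exact ⟨p, hp, p', hp', _, (apex_rep r3 _ _ _).iso ψ⟩
    · obtain ⟨p, hp, r2⟩ := step r1 ((SimpleGraph.mem_edgeSet _).1 he1)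
      have ha : (subdivide (subdivide H x y) x1 y1).Adj none (some y1) := by
        rw [subdivide, SimpleGraph.fromRel_adj]
        exact ⟨by simp, Or.inr (Or.inr rfl)⟩
      obtain ⟨p', hp', r3⟩ := step r2 ha
      exact ⟨p, hp, p', hp', _, (apex_rep r3 _ _ _).iso ψ⟩

theorem part4 {V : Type} (G : SimpleGraph V) (h : MemF 4 2 G) (hg : 5 ≤ G.egirth) :
    Nonempty (G ≃g Rgraph) := by
  obtain ⟨_, H3, _, _, h3, a3, i3⟩ := inv_subd (by omega) (by omega) h
  obtain ⟨_, H2, _, _, h2, a2, i2⟩ := inv_subd (by omega) (by omega) h3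
  obtain ⟨e1, m1, e2, m2, f2, r2⟩ := inv22 h2
  obtain ⟨e3, m3, f3, r3⟩ := step_iso r2 a2 i2
  obtain ⟨e4, m4, f4, r4⟩ := step_iso r3 a3 i3
  have hc := check42_true
  simp only [check42, check42a, check42b, check42b', check42c, List.all_eq_true] at hc
  have hc' := hc e1 m1 e2 m2 e3 m3 e4 m4
  rw [Bool.or_eq_true, List.any_eq_true] at hc'
  rcases hc' with ⟨c, hc1, hc2⟩ | hc'
  · simp only [List.mem_filter, Bool.not_eq_true'] at hc1 hc2
    exact (cert_sound r4 hg c (cert_persist (cert_persist hc1.1.2 hc1.2) hc2)).elim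
  · rw [check42d, Bool.or_eq_true] at hc'
    rcases hc' with hc' | hc'
    · exact (cert_sound r4 hg _ hc').elim
    · obtain ⟨φ⟩ := checkIso_sound r4 _ hc'
      exact ⟨φ.symm⟩

theorem part2 : MemF 4 2 Rgraph := by
  -- subdivide edge `01`, then `02` and `13`, then the edges `05` and `16`
  have r1 := sub_rep rep_K4 0 1
  have r2 := sub_rep r1 (some 0) (some 2)
  have r3 := sub_rep r2 (some (some 1)) (some (some 3))
  have r4 := apex_rep r3 (some (some none)) (some none) none
  have r5 := sub_rep r4 (some (some (some (some 0)))) (some (some none))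
  have r6 := sub_rep r5 (some (some (some (some (some 1))))) (some (some none))
  have hiso := checkIso_sound r6 [8, 9, 1, 4, 0, 5, 6, 2, 7, 3] (by decide +kernel)
  refine MemF.subd (by omega) (MemF.subd (by omega) (MemF.circ (j := 2) le_rfl
    (MemF.k4 ⟨RelIso.refl _⟩) (x := 0) (y := 1) (by simp) (e1 := s(some 0, some 2))
    (e2 := s(some 1, some 3)) ?_ ?_ (Or.inl ⟨?_, _, _, _, _, rfl, rfl, ⟨RelIso.refl _⟩⟩))
    ?_ ⟨RelIso.refl _⟩) ?_ hiso
  · rw [SimpleGraph.mem_edgeSet, r1.adj]; decide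
  · rw [SimpleGraph.mem_edgeSet, r1.adj]; decide
  · decide
  · rw [r4.adj]; decide
  · rw [r5.adj]; decide

/-- members of `F_{4,j}` with girth at least 5 have `j ≥ 2`, and `R` is,
up to isomorphism, the unique member of `F_{4,2}` with girth at least 5. -/
theorem statement9 :
    (∀ {V : Type} (G : SimpleGraph V) (j : ℕ), j ≤ 4 → MemF 4 j G →
      5 ≤ G.egirth → 2 ≤ j) ∧
    MemF 4 2 Rgraph ∧ 5 ≤ Rgraph.egirth ∧
    (∀ {V : Type} (G : SimpleGraph V), MemF 4 2 G → 5 ≤ G.egirth →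
      Nonempty (G ≃g Rgraph)) := by
  exact ⟨fun G j _ h hg => part1 G j h hg, part2, R_girth, fun G h hg => part4 G h hg⟩

end InducedForest
end
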